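/- Let F be a finitely generated free group and p a prime. Then every finitely presented right F_p[F]-module is residually finite. -/

import Mathlib

/-- A right `R`-module (i.e. a left `Rᵐᵒᵖ`-module) is *residually finite* if every nonzero
element avoids some submodule of finite index. -/
def ResiduallyFiniteRightModule (R : Type*) [Ring R] (M : Type*) [AddCommGroup M]
    [Module Rᵐᵒᵖ M] : Prop :=
  ∀ m : M, m ≠ 0 → ∃ N : Submodule Rᵐᵒᵖ M, Finite (M ⧸ N) ∧ m ∉ N

namespace FreeGroupAlgebra

open MulOpposite

/-- A linear automorphism `f` of `M` induces a partial automorphism of each finite-dimensional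
subspace `W`, which extends to an automorphism of `W`. -/
theorem exists_linearEquiv_of_mem {k M : Type*} [Field k] [AddCommGroup M] [Module k M]
    (W : Submodule k M) [FiniteDimensional k W] (f : M ≃ₗ[k] M) :
    ∃ e : W ≃ₗ[k] W, ∀ w : W, f w ∈ W → (e w : M) = f w := by
  let D : Submodule k W := (W.comap f.toLinearMap).comap W.subtype
  let g : D →ₗ[k] W := (f.toLinearMap ∘ₗ W.subtype ∘ₗ D.subtype).codRestrict W fun d ↦ d.2
  have hg : Function.Injective g := fun a b h ↦ by
    have h' : f a = f b := congrArg (Subtype.val : W → M) h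
    exact Subtype.ext (Subtype.ext (f.injective h'))
  obtain ⟨C, hC⟩ := D.exists_isCompl
  obtain ⟨C', hC'⟩ := (LinearMap.range g).exists_isCompl
  let g' : D ≃ₗ[k] LinearMap.range g := LinearEquiv.ofInjective g hg
  have hdim : Module.finrank k C = Module.finrank k C' := by
    have h₁ := Submodule.finrank_add_eq_of_isCompl hC
    have h₂ := Submodule.finrank_add_eq_of_isCompl hC'
    have h₃ := g'.finrank_eq
    omega
  let c : C ≃ₗ[k] C' := LinearEquiv.ofFinrankEq C C' hdim
  refine ⟨(Submodule.prodEquivOfIsCompl D C hC).symm ≪≫ₗ (g'.prodCongr c) ≪≫ₗ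
    Submodule.prodEquivOfIsCompl _ C' hC', fun w hw ↦ ?_⟩
  have h := Submodule.prodEquivOfIsCompl_symm_apply_left D C hC ⟨w, hw⟩
  simp only [LinearEquiv.trans_apply]
  rw [h]
  simp only [LinearEquiv.prodCongr_apply, map_zero, Submodule.coe_prodEquivOfIsCompl',
    ZeroMemClass.coe_zero, add_zero]
  rfl

theorem closure_range_of (F : Type*) [Group F] [IsFreeGroup F] :
    Subgroup.closure (Set.range (IsFreeGroup.of : IsFreeGroup.Generators F → F)) = ⊤ := by
  have h : (IsFreeGroup.of : IsFreeGroup.Generators F → F) =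
      (IsFreeGroup.mulEquiv F).toMonoidHom ∘ FreeGroup.of := rfl
  rw [h, Set.range_comp, ← MonoidHom.map_closure, FreeGroup.closure_range_of,
    ← MonoidHom.range_eq_map]
  exact MonoidHom.range_eq_top.mpr (IsFreeGroup.mulEquiv F).surjective

section

variable {k F : Type*} [Field k] [Group F]

variable (k) in
/-- A group element, as an element of the opposite of the group algebra. -/
noncomputable def opOf (g : F) : (MonoidAlgebra k F)ᵐᵒᵖ := op (MonoidAlgebra.of k F g)

theorem opOf_one : opOf k (1 : F) = 1 := by
  simp [opOf, MonoidAlgebra.one_def]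

theorem opOf_mul (g h : F) : opOf k (g * h) = opOf k h * opOf k g := by
  simp only [opOf, map_mul, op_mul]

variable {ι M : Type*} [DecidableEq ι] [AddCommGroup M] [Module k M]
  [Module (MonoidAlgebra k F)ᵐᵒᵖ M] [IsScalarTower k (MonoidAlgebra k F)ᵐᵒᵖ M]

variable (k M) in
/-- The action of a group element on a right module over the group algebra. -/
noncomputable def actEquiv (g : F) : M ≃ₗ[k] M :=
  LinearEquiv.ofLinearMap (Module.toModuleEnd k (S := (MonoidAlgebra k F)ᵐᵒᵖ) M (opOf k g))
    (Module.toModuleEnd k (S := (MonoidAlgebra k F)ᵐᵒᵖ) M (opOf k g⁻¹))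
    (by ext m; simp [← mul_smul, ← opOf_mul, opOf_one])
    (by ext m; simp [← mul_smul, ← opOf_mul, opOf_one])

theorem actEquiv_apply (g : F) (m : M) : actEquiv k M g m = opOf k g • m := rfl

variable [IsFreeGroup F]

/-- A linear map `φ` into the subspace `W` which agrees with the module map `π` on the standard
basis and commutes with each free generator and its inverse as long as the action of that element
in `M` stays in `W`. -/
structure IsLocalModel (π : (ι → (MonoidAlgebra k F)ᵐᵒᵖ) →ₗ[(MonoidAlgebra k F)ᵐᵒᵖ] M)
    (W : Submodule k M) (φ : (ι → (MonoidAlgebra k F)ᵐᵒᵖ) →ₗ[k] M) : Prop where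
  mem : ∀ y, φ y ∈ W
  single : ∀ i, φ (Pi.single i 1) = π (Pi.single i 1)
  of_smul : ∀ (x : IsFreeGroup.Generators F) y, opOf k (IsFreeGroup.of x) • φ y ∈ W →
    φ (opOf k (IsFreeGroup.of x) • y) = opOf k (IsFreeGroup.of x) • φ y
  inv_smul : ∀ (x : IsFreeGroup.Generators F) y, opOf k (IsFreeGroup.of x)⁻¹ • φ y ∈ W →
    φ (opOf k (IsFreeGroup.of x)⁻¹ • y) = opOf k (IsFreeGroup.of x)⁻¹ • φ y

theorem IsLocalModel.exists_apply_eq_opOf_smul_single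
    (π : (ι → (MonoidAlgebra k F)ᵐᵒᵖ) →ₗ[(MonoidAlgebra k F)ᵐᵒᵖ] M) (i : ι) (g : F) :
    ∃ W₀ : Submodule k M, W₀.FG ∧ ∀ W φ, W₀ ≤ W → IsLocalModel π W φ →
      φ (opOf k g • Pi.single i 1) = π (opOf k g • Pi.single i 1) := by
  have hg : g ∈ Subgroup.closure (Set.range (IsFreeGroup.of : IsFreeGroup.Generators F → F)) :=
    closure_range_of F ▸ Subgroup.mem_top g
  induction hg using Subgroup.closure_induction_right with
  | one => exact ⟨⊥, Submodule.fg_bot, fun W φ _ h ↦ by simpa [opOf_one] using h.single i⟩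
  | mul_right g _ x hx ih =>
    obtain ⟨x, rfl⟩ := hx
    obtain ⟨W₀, hfg, hW₀⟩ := ih
    let v := opOf k (IsFreeGroup.of x) • π (opOf k g • Pi.single i 1)
    refine ⟨W₀ ⊔ k ∙ v, hfg.sup (Submodule.fg_span_singleton v), fun W φ hW h ↦ ?_⟩
    have hg := hW₀ W φ (le_sup_left.trans hW) h
    have hv : v ∈ W := hW (le_sup_right (a := W₀) (Submodule.mem_span_singleton_self v))
    rw [opOf_mul, mul_smul, h.of_smul x _ (by rwa [hg]), hg, map_smul π (opOf k (IsFreeGroup.of x))]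
  | mul_inv_cancel g _ x hx ih =>
    obtain ⟨x, rfl⟩ := hx
    obtain ⟨W₀, hfg, hW₀⟩ := ih
    let v := opOf k (IsFreeGroup.of x)⁻¹ • π (opOf k g • Pi.single i 1)
    refine ⟨W₀ ⊔ k ∙ v, hfg.sup (Submodule.fg_span_singleton v), fun W φ hW h ↦ ?_⟩
    have hg := hW₀ W φ (le_sup_left.trans hW) h
    have hv : v ∈ W := hW (le_sup_right (a := W₀) (Submodule.mem_span_singleton_self v))
    rw [opOf_mul, mul_smul, h.inv_smul x _ (by rwa [hg]), hg,
      map_smul π (opOf k (IsFreeGroup.of x)⁻¹)]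

/-- Every local model on a sufficiently large subspace agrees with `π` at a given vector. -/
theorem IsLocalModel.exists_apply_eq [Finite ι]
    (π : (ι → (MonoidAlgebra k F)ᵐᵒᵖ) →ₗ[(MonoidAlgebra k F)ᵐᵒᵖ] M)
    (y : ι → (MonoidAlgebra k F)ᵐᵒᵖ) :
    ∃ W₀ : Submodule k M, W₀.FG ∧ ∀ W φ, W₀ ≤ W → IsLocalModel π W φ → φ y = π y := by
  induction y using Pi.single_induction with
  | zero => exact ⟨⊥, Submodule.fg_bot, fun W φ _ _ ↦ by simp⟩
  | add y z hy hz =>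
    obtain ⟨W₁, hfg₁, h₁⟩ := hy
    obtain ⟨W₂, hfg₂, h₂⟩ := hz
    refine ⟨W₁ ⊔ W₂, hfg₁.sup hfg₂, fun W φ hW h ↦ ?_⟩
    rw [map_add, map_add, h₁ W φ (le_sup_left.trans hW) h, h₂ W φ (le_sup_right.trans hW) h]
  | single i a =>
    induction a using MulOpposite.rec' with
    | _ a =>
    induction a using MonoidAlgebra.induction_linear with
    | zero => exact ⟨⊥, Submodule.fg_bot, fun W φ _ _ ↦ by simp⟩
    | add y z hy hz =>
      obtain ⟨W₁, hfg₁, h₁⟩ := hy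
      obtain ⟨W₂, hfg₂, h₂⟩ := hz
      refine ⟨W₁ ⊔ W₂, hfg₁.sup hfg₂, fun W φ hW h ↦ ?_⟩
      rw [op_add, Pi.single_add, map_add, map_add, h₁ W φ (le_sup_left.trans hW) h,
        h₂ W φ (le_sup_right.trans hW) h]
    | single g r =>
      obtain ⟨W₀, hfg, hW₀⟩ := exists_apply_eq_opOf_smul_single π i g
      refine ⟨W₀, hfg, fun W φ hW h ↦ ?_⟩
      have key : (Pi.single i (op (MonoidAlgebra.single g r)) : ι → (MonoidAlgebra k F)ᵐᵒᵖ) =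
          r • opOf k g • Pi.single i 1 := by
        rw [← Pi.single_smul, ← Pi.single_smul]
        simp [opOf, ← op_smul]
      rw [key, map_smul, hW₀ W φ hW h, LinearMap.map_smul_of_tower π r]

/-- Local models exist on every finite-dimensional subspace containing the images of the standard
basis; they can be chosen to be linear for some module structure on the subspace. -/
theorem IsLocalModel.exists_of_single_mem [Finite ι]
    (π : (ι → (MonoidAlgebra k F)ᵐᵒᵖ) →ₗ[(MonoidAlgebra k F)ᵐᵒᵖ] M)
    (W : Submodule k M) [FiniteDimensional k W] (hW : ∀ i, π (Pi.single i 1) ∈ W) :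
    ∃ φ, IsLocalModel π W φ ∧
      ∃ N : Submodule (MonoidAlgebra k F)ᵐᵒᵖ (ι → (MonoidAlgebra k F)ᵐᵒᵖ),
        ∀ y, y ∈ N ↔ φ y = 0 := by
  cases nonempty_fintype ι
  choose e he using fun x : IsFreeGroup.Generators F ↦
    exists_linearEquiv_of_mem W (actEquiv k M (IsFreeGroup.of x))
  let σ : F →* (W ≃ₗ[k] W)ᵐᵒᵖ := IsFreeGroup.lift fun x ↦ op (e x)
  let τ : MonoidAlgebra k F →ₐ[k] (Module.End k W)ᵐᵒᵖ := MonoidAlgebra.lift k _ F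
    ((MonoidHom.op (LinearEquiv.automorphismGroup.toLinearMapMonoidHom (R := k) (M := W))).comp σ)
  let ρ : (MonoidAlgebra k F)ᵐᵒᵖ →ₐ[k] Module.End k W :=
    ((AlgEquiv.opOp k (Module.End k W)).symm : _ →ₐ[k] _).comp (AlgHom.op τ)
  have hρ (g : F) (w : W) : ρ (opOf k g) w = (σ g).unop w := by
    simp [ρ, τ, opOf]
  let φ : (ι → (MonoidAlgebra k F)ᵐᵒᵖ) →ₗ[k] W :=
    ∑ i, (LinearMap.applyₗ ⟨π (Pi.single i 1), hW i⟩ ∘ₗ ρ.toLinearMap) ∘ₗ LinearMap.proj i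
  have hφ (y) : φ y = ∑ i, ρ (y i) ⟨π (Pi.single i 1), hW i⟩ := by simp [φ]
  have hsmul (s : (MonoidAlgebra k F)ᵐᵒᵖ) (y) : φ (s • y) = ρ s (φ y) := by
    simp [hφ]
  refine ⟨W.subtype ∘ₗ φ, ⟨fun y ↦ (φ y).2, fun i ↦ ?_, fun x y h ↦ ?_, fun x y h ↦ ?_⟩,
    { carrier := {y | φ y = 0}
      add_mem' := fun {a b} ha hb ↦ by
        rw [Set.mem_ofPred_eq] at *
        rw [map_add, ha, hb, add_zero]
      zero_mem' := by simp
      smul_mem' := fun s y hy ↦ by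
        rw [Set.mem_ofPred_eq] at *
        rw [hsmul, hy, map_zero] }, fun y ↦ by simp⟩
  · have : φ (Pi.single i 1) = ⟨π (Pi.single i 1), hW i⟩ := by
      rw [hφ, Finset.sum_eq_single i]
      · simp
      · intro j _ hj
        simp [Pi.single_eq_of_ne hj]
      · simp
    simp [this]
  · have h' := he x (φ y) h
    rw [actEquiv_apply] at h'
    simpa [hsmul, hρ, σ] using h'
  · have h' := he x ⟨_, h⟩ (by simp [actEquiv_apply, ← mul_smul, ← opOf_mul, opOf_one])
    simp only [actEquiv_apply, ← mul_smul, ← opOf_mul, inv_mul_cancel, opOf_one, one_smul] at h'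
    have h'' : e x ⟨_, h⟩ = φ y := Subtype.ext h'
    simp only [LinearMap.comp_apply, hsmul, hρ, map_inv, σ, IsFreeGroup.lift_of, unop_inv, unop_op]
    exact congrArg Subtype.val ((e x).symm_apply_eq.mpr h''.symm)

end

theorem residuallyFinite_of_finitePresentation {k F M : Type*} [Field k] [Finite k] [Group F]
    [IsFreeGroup F] [AddCommGroup M] [Module k M] [Module (MonoidAlgebra k F)ᵐᵒᵖ M]
    [IsScalarTower k (MonoidAlgebra k F)ᵐᵒᵖ M]
    [Module.FinitePresentation (MonoidAlgebra k F)ᵐᵒᵖ M] :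
    ResiduallyFiniteRightModule (MonoidAlgebra k F) M := by
  intro m hm
  obtain ⟨n, r, π, g, hπ, hex⟩ :=
    Module.FinitePresentation.exists_fin' (MonoidAlgebra k F)ᵐᵒᵖ M
  obtain ⟨y₀, rfl⟩ := hπ m
  choose V hV hVφ using IsLocalModel.exists_apply_eq (k := k) π
  let W : Submodule k M := V y₀ ⊔ (⨆ j, V (g (Pi.single j 1))) ⊔
    Submodule.span k (Set.range fun i ↦ π (Pi.single i 1))
  have hWfg : W.FG := ((hV y₀).sup (Submodule.fg_iSup _ fun j ↦ hV _)).sup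
    (Submodule.fg_span (Set.finite_range _))
  have : FiniteDimensional k W := Module.Finite.iff_fg.mpr hWfg
  have : Finite W := Module.finite_of_finite k
  obtain ⟨φ, hφ, N, hN⟩ := IsLocalModel.exists_of_single_mem π W fun i ↦
    le_sup_right (a := V y₀ ⊔ ⨆ j, V (g (Pi.single j 1))) (Submodule.subset_span ⟨i, rfl⟩)
  have hgN : LinearMap.range g ≤ N := by
    rw [LinearMap.range_eq_map, ← (Pi.basisFun (MonoidAlgebra k F)ᵐᵒᵖ (Fin r)).span_eq,
      Submodule.map_span_le]
    rintro _ ⟨j, rfl⟩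
    rw [hN, Pi.basisFun_apply, hVφ _ W φ ?_ hφ]
    · exact hex.apply_apply_eq_zero _
    · exact (le_iSup (fun j ↦ V (g (Pi.single j 1))) j).trans (le_sup_right.trans le_sup_left)
  refine ⟨N.map π, ?_, ?_⟩
  · have (w : Set.range φ) : ∃ y, φ y = w := w.2
    choose s hs using this
    have : Finite (Set.range φ) :=
      Set.Finite.subset (Set.toFinite (W : Set M)) (by rintro _ ⟨y, rfl⟩; exact hφ.mem y)
    refine Finite.of_surjective (fun w ↦ (N.map π).mkQ (π (s w))) fun q ↦ ?_
    obtain ⟨m, rfl⟩ := (N.map π).mkQ_surjective q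
    obtain ⟨y, rfl⟩ := hπ m
    refine ⟨⟨φ y, y, rfl⟩, ?_⟩
    rw [← sub_eq_zero, ← map_sub, ← map_sub, Submodule.mkQ_apply, Submodule.Quotient.mk_eq_zero]
    refine Submodule.mem_map_of_mem ((hN _).mpr ?_)
    rw [map_sub, hs, sub_self]
  · rintro ⟨y, hy, hyy⟩
    have h₁ : y₀ - y ∈ N := hgN ((hex _).mp (by rw [map_sub, hyy, sub_self]))
    have h₂ : y₀ ∈ N := by simpa using N.add_mem h₁ hy
    rw [hN, hVφ y₀ W φ (le_sup_left.trans le_sup_left) hφ] at h₂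
    exact hm h₂

end FreeGroupAlgebra

/-- Let `F` be a finitely generated free group and `p` a prime.  Then every
finitely presented right `F_p[F]`-module is residually finite. -/
theorem statement16 (F : Type) [Group F] [IsFreeGroup F] (hfg : Group.FG F)
    (p : ℕ) (hp : p.Prime)
    (M : Type) [AddCommGroup M] [Module (MonoidAlgebra (ZMod p) F)ᵐᵒᵖ M]
    (hM : Module.FinitePresentation (MonoidAlgebra (ZMod p) F)ᵐᵒᵖ M) :
    ResiduallyFiniteRightModule (MonoidAlgebra (ZMod p) F) M := by
  have : Fact p.Prime := ⟨hp⟩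
  let _ : Module (ZMod p) M :=
    Module.compHom M (algebraMap (ZMod p) (MonoidAlgebra (ZMod p) F)ᵐᵒᵖ)
  have : IsScalarTower (ZMod p) (MonoidAlgebra (ZMod p) F)ᵐᵒᵖ M :=
    ⟨fun a s m ↦ by rw [Algebra.smul_def, mul_smul]; rfl⟩
  exact FreeGroupAlgebra.residuallyFinite_of_finitePresentation (k := ZMod p)
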